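/- With the notation of the main sprinkled decoupling theorem, there exists a universal constant $c > 0$ such that for all increasing events $A_1 \in \sigma(I_1)$, $A_2 \in \sigma(I_2)$, and $\varepsilon > 0$: $\Pr[X - \varepsilon\mathbf{1} \in A_1]\Pr[X - \varepsilon\mathbf{1} \in A_2] - \Pr[X \in A_1 \cap A_2] \le c\,\|K_{I_1,I_2}\|_\infty / \varepsilon^2$. Moreover, if $K(i,j) \ge 0$ for all $i \in I_1, j \in I_2$, then the left-hand side is at most $0$. -/

import Mathlib

open MeasureTheory ProbabilityTheory

/-- An event `A ⊆ ℝⁿ` is increasing if it is closed under adding coordinatewise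
nonnegative vectors. -/
def IncreasingEvent {n : ℕ} (A : Set (Fin n → ℝ)) : Prop :=
  ∀ x ∈ A, ∀ v : Fin n → ℝ, (∀ i, 0 ≤ v i) → x + v ∈ A

/-- An event `A` is supported on `I` if membership is unchanged by modifying
coordinates outside `I`. -/
def SupportedOn {n : ℕ} (A : Set (Fin n → ℝ)) (I : Set (Fin n)) : Prop :=
  ∀ x y : Fin n → ℝ, (∀ i ∈ I, x i = y i) → (x ∈ A ↔ y ∈ A)

/-- `X` is a Gaussian vector: every linear combination of coordinates is Gaussian. -/
def IsGaussianVector {Ω : Type*} [MeasureSpace Ω] {n : ℕ} (X : Ω → Fin n → ℝ) : Prop :=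
  ∀ a : Fin n → ℝ, ∃ (m : ℝ) (v : NNReal),
    Measure.map (fun ω => ∑ i, a i * X ω i) ℙ = gaussianReal m v

/-- The threshold `T_A(x) = sup {u : x - u·𝟙 ∈ A}` of an increasing event. -/
noncomputable def thr {n : ℕ} (A : Set (Fin n → ℝ)) (x : Fin n → ℝ) : ℝ :=
  sSup {u : ℝ | (fun i => x i - u) ∈ A}

/-- `‖K_{I₁,I₂}‖_∞ = max_{i ∈ I₁, j ∈ I₂} |K(i,j)|`. -/
noncomputable def kNorm {n : ℕ} (K : Fin n → Fin n → ℝ) (I1 I2 : Finset (Fin n)) : ℝ :=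
  sSup {r : ℝ | ∃ i ∈ I1, ∃ j ∈ I2, r = |K i j|}

open scoped Convolution

/-- A bounded increasing `C^{1,1}` function `F` on `ℝⁿ`, with gradient `F'`, that depends only on
the coordinates in `I` and is `L`-Lipschitz for the supremum norm. -/
structure SmoothIncreasing {n : ℕ} (I : Finset (Fin n)) (L M : ℝ)
    (F : (Fin n → ℝ) → ℝ) (F' : (Fin n → ℝ) → Fin n → ℝ) : Prop where
  continuous : Continuous F
  continuous_grad : Continuous F'
  nonneg : ∀ x, 0 ≤ F x
  le_one : ∀ x, F x ≤ 1
  lipschitz : ∀ x v, |F (x + v) - F x| ≤ L * ‖v‖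
  grad_nonneg : ∀ x i, 0 ≤ F' x i
  sum_grad_le : ∀ x, ∑ i, F' x i ≤ L
  grad_eq_zero : ∀ x, ∀ i ∉ I, F' x i = 0
  taylor : ∀ x v, |F (x + v) - F x - ∑ i, F' x i * v i| ≤ M * ‖v‖ ^ 2

/-- The mollification of a bounded increasing Lipschitz function is bounded, increasing and
`C^{1,1}`, and agrees with the original function where the latter is locally constant. -/
theorem exists_smoothIncreasing_of_lipschitz {n : ℕ} {I : Finset (Fin n)} {L r : ℝ} (hr : 0 < r)
    {g : (Fin n → ℝ) → ℝ} (hL : 0 ≤ L) (hg0 : ∀ x, 0 ≤ g x) (hg1 : ∀ x, g x ≤ 1)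
    (hgL : ∀ x y, |g x - g y| ≤ L * ‖x - y‖)
    (hmono : ∀ x v : Fin n → ℝ, (∀ i, 0 ≤ v i) → g x ≤ g (x + v))
    (hI : ∀ x y, (∀ i ∈ I, x i = y i) → g x = g y) :
    ∃ F F' M, 0 ≤ M ∧ SmoothIncreasing I L M F F' ∧
      ∀ x, (∀ y ∈ Metric.ball x r, g y = g x) → F x = g x := by
  have hgc : Continuous g := by
    refine (LipschitzWith.of_dist_le_mul (K := ⟨L, hL⟩) fun x y => ?_).continuous
    rw [Real.dist_eq, dist_eq_norm]
    exact hgL x y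
  let ρ : ContDiffBump (0 : Fin n → ℝ) := ⟨r / 2, r, by linarith, by linarith⟩
  set f := ρ.normed volume with hf
  have hf0 : ∀ x, 0 ≤ f x := ρ.nonneg_normed
  have hfi : Integrable f := ρ.integrable_normed
  have hf1 : ∫ x, f x = 1 := ρ.integral_normed
  have hfc : HasCompactSupport f := ρ.hasCompactSupport_normed
  have hfs : ContDiff ℝ 1 f := ρ.contDiff_normed (n := 1)
  set F := f ⋆[ContinuousLinearMap.lsmul ℝ ℝ, volume] g with hF
  have hFx : ∀ x, F x = ∫ t, f t * g (x - t) := fun x => rfl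
  have hint : ∀ x, Integrable fun t => f t * g (x - t) := by
    intro x
    refine hfi.mul_bdd (c := 1) (by fun_prop) (ae_of_all _ fun t => ?_)
    rw [Real.norm_eq_abs, abs_of_nonneg (hg0 _)]
    exact hg1 _
  have hFL : ∀ x y, |F x - F y| ≤ L * ‖x - y‖ := by
    intro x y
    rw [hFx, hFx, ← integral_sub (hint x) (hint y), ← Real.norm_eq_abs]
    calc _ ≤ ∫ t, f t * (L * ‖x - y‖) := by
          refine norm_integral_le_of_norm_le (hfi.mul_const _) (ae_of_all _ fun t => ?_)
          rw [← mul_sub, norm_mul, Real.norm_eq_abs, Real.norm_eq_abs, abs_of_nonneg (hf0 t)]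
          refine mul_le_mul_of_nonneg_left ?_ (hf0 t)
          simpa using hgL (x - t) (y - t)
      _ = _ := by rw [integral_mul_const, hf1, one_mul]
  have hFmono : ∀ x v : Fin n → ℝ, (∀ i, 0 ≤ v i) → F x ≤ F (x + v) := by
    intro x v hv
    rw [hFx, hFx]
    refine integral_mono (hint _) (hint _) fun t => mul_le_mul_of_nonneg_left ?_ (hf0 t)
    rw [add_sub_right_comm]
    exact hmono _ _ hv
  set P := (ContinuousLinearMap.lsmul ℝ ℝ : ℝ →L[ℝ] ℝ →L[ℝ] ℝ).precompL (Fin n → ℝ) with hP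
  set D := fderiv ℝ f ⋆[P, volume] g with hD
  have hderiv : ∀ x, HasFDerivAt F (D x) x := fun x =>
    hfc.hasFDerivAt_convolution_left _ hfs hgc.locallyIntegrable x
  have hDx : ∀ x, D x = ∫ t, P (fderiv ℝ f t) (g (x - t)) := fun x => rfl
  have hPle : ∀ (T : (Fin n → ℝ) →L[ℝ] ℝ) (b : ℝ), ‖P T b‖ ≤ ‖T‖ * ‖b‖ := by
    intro T b
    refine ContinuousLinearMap.opNorm_le_bound _ (by positivity) fun v => ?_
    calc ‖P T b v‖ = ‖T v‖ * ‖b‖ := by rw [← norm_mul]; rfl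
      _ ≤ ‖T‖ * ‖v‖ * ‖b‖ := by gcongr; exact T.le_opNorm v
      _ = ‖T‖ * ‖b‖ * ‖v‖ := by ring
  have hDint : ∀ x, Integrable fun t => P (fderiv ℝ f t) (g (x - t)) := fun x =>
    HasCompactSupport.convolutionExists_left P (hfc.fderiv ℝ) (hfs.continuous_fderiv one_ne_zero)
      hgc.locallyIntegrable x
  have hf'int : Integrable fun t => ‖fderiv ℝ f t‖ :=
    ((hfs.continuous_fderiv one_ne_zero).integrable_of_hasCompactSupport (hfc.fderiv ℝ)).norm
  set C := L * ∫ t, ‖fderiv ℝ f t‖ with hC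
  have hC0 : 0 ≤ C := by
    have : 0 ≤ ∫ t, ‖fderiv ℝ f t‖ := integral_nonneg fun t => norm_nonneg _
    positivity
  have hDL : ∀ x y, ‖D x - D y‖ ≤ C * ‖x - y‖ := by
    intro x y
    rw [hDx, hDx, ← integral_sub (hDint x) (hDint y)]
    calc _ ≤ ∫ t, ‖fderiv ℝ f t‖ * (L * ‖x - y‖) := by
          refine norm_integral_le_of_norm_le (hf'int.mul_const _)
            (ae_of_all _ fun t => ?_)
          rw [← map_sub]
          refine (hPle _ _).trans ?_
          gcongr
          simpa using hgL (x - t) (y - t)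
      _ = _ := by rw [integral_mul_const]; ring
  have hDc : Continuous D := by
    refine (LipschitzWith.of_dist_le_mul (K := ⟨C, hC0⟩) fun x y => ?_).continuous
    rw [dist_eq_norm, dist_eq_norm]
    exact hDL x y
  have hDsum : ∀ x v, D x v = ∑ i, D x (Pi.single i 1) * v i := by
    intro x v
    conv_lhs => rw [← Finset.univ_sum_single v]
    rw [map_sum]
    refine Finset.sum_congr rfl fun i _ => ?_
    rw [← mul_comm, ← smul_eq_mul, ← map_smul, ← Pi.single_smul, smul_eq_mul, mul_one]
  have hline : ∀ x v : Fin n → ℝ, HasDerivAt (fun t : ℝ => F (x + t • v)) (D x v) 0 := by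
    intro x v
    have h1 : HasDerivAt (fun t : ℝ => x + t • v) v 0 := by
      simpa using ((hasDerivAt_id (0 : ℝ)).smul_const v).const_add x
    have h2 : HasFDerivAt F (D x) (x + (0 : ℝ) • v) := by simpa using hderiv x
    exact h2.comp_hasDerivAt 0 h1
  refine ⟨F, fun x i => D x (Pi.single i 1), C, hC0, ?_, fun x hx => ?_⟩
  · constructor
    · exact continuous_iff_continuousAt.2 fun x => (hderiv x).continuousAt
    · fun_prop
    · exact fun x => integral_nonneg fun t => mul_nonneg (hf0 _) (hg0 _)
    · intro x
      rw [hFx, ← hf1]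
      exact integral_mono (hint x) hfi fun t => mul_le_of_le_one_right (hf0 _) (hg1 _)
    · intro x v
      simpa using hFL (x + v) x
    · intro x i
      have hmon : Monotone fun t : ℝ => F (x + t • Pi.single i 1) := by
        intro s t hst
        have := hFmono (x + s • Pi.single i 1) ((t - s) • Pi.single i 1) fun j => by
          rcases eq_or_ne j i with rfl | hj
          · simpa using hst
          · simp [hj]
        rwa [add_assoc, ← add_smul, add_sub_cancel] at this
      rw [← (hline x (Pi.single i 1)).deriv]
      exact hmon.deriv_nonneg
    · intro x
      have h1 : ∑ i, D x (Pi.single i 1) = D x 1 := by simp [hDsum x 1]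
      have h2 : ‖D x‖ ≤ L := by
        refine (hderiv x).le_of_lip' hL (Filter.Eventually.of_forall fun y => ?_)
        exact hFL y x
      rw [h1]
      calc D x 1 ≤ ‖D x 1‖ := Real.le_norm_self _
        _ ≤ ‖D x‖ * ‖(1 : Fin n → ℝ)‖ := (D x).le_opNorm _
        _ ≤ L * 1 := by
          gcongr
          exact (pi_norm_le_iff_of_nonneg zero_le_one).2 fun i => by simp
        _ = L := mul_one L
    · intro x i hi
      have hconst : (fun t : ℝ => F (x + t • Pi.single i 1)) = fun _ => F x := by
        funext t
        rw [hFx, hFx]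
        refine integral_congr_ae (ae_of_all _ fun s => ?_)
        simp only
        congr 1
        refine hI _ _ fun j hj => ?_
        have : j ≠ i := fun h => hi (h ▸ hj)
        simp [this]
      have := hline x (Pi.single i 1)
      rw [hconst] at this
      exact this.unique (hasDerivAt_const _ _)
    · intro x v
      rw [← hDsum x v, ← Real.norm_eq_abs]
      have := (convex_segment x (x + v)).norm_image_sub_le_of_norm_hasFDerivWithin_le'
        (f := F) (f' := D) (φ := D x) (C := C * ‖v‖)
        (fun z _ => (hderiv z).hasFDerivWithinAt) (fun z hz => ?_)
        (left_mem_segment ℝ x (x + v)) (right_mem_segment ℝ x (x + v))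
      · rw [add_sub_cancel_left] at this
        rwa [pow_two, ← mul_assoc]
      · refine (hDL z x).trans (mul_le_mul_of_nonneg_left ?_ hC0)
        simpa using norm_sub_le_of_mem_segment hz
  · exact ρ.normed_convolution_eq_right hx

/-- An increasing event can be approximated by smooth increasing functions, up to a shift. -/
theorem exists_smoothIncreasing_of_increasingEvent {n : ℕ} {I : Finset (Fin n)}
    {A : Set (Fin n → ℝ)} (hA : IncreasingEvent A) (hAI : SupportedOn A ↑I) {ε : ℝ} (hε : 0 < ε) :
    ∃ F F' M, 0 ≤ M ∧ SmoothIncreasing I (2 / ε) M F F' ∧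
      (∀ x : Fin n → ℝ, (fun i => x i - ε) ∈ A → F x = 1) ∧ (∀ x, x ∉ A → F x = 0) := by
  rcases A.eq_empty_or_nonempty with rfl | hne
  · refine ⟨fun _ => 0, fun _ _ => 0, 0, le_rfl, ?_, by simp, by simp⟩
    constructor <;> intros <;> first | fun_prop | simp <;> positivity
  have key : ∀ x y : Fin n → ℝ, ∀ a ∈ A, (∀ i, a i ≤ y i) → y ∈ A := by
    intro x y a ha h
    have := hA a ha (y - a) fun i => sub_nonneg.2 (h i)
    rwa [add_sub_cancel] at this
  let s : Fin n → ℝ := fun _ => 3 * ε / 4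
  let d : (Fin n → ℝ) → ℝ := fun x => Metric.infDist (x - s) A
  have hdL : ∀ x y, d x - d y ≤ ‖x - y‖ := by
    intro x y
    have := Metric.infDist_le_infDist_add_dist (s := A) (x := x - s) (y := y - s)
    rw [dist_eq_norm, sub_sub_sub_cancel_right] at this
    simp only [d]
    linarith
  have hd_le : ∀ x y, (∀ a ∈ A, a + (y - x) ∈ A) → d y ≤ d x := by
    intro x y h
    refine (Metric.le_infDist hne).2 fun a ha => ?_
    have := Metric.infDist_le_dist_of_mem (x := y - s) (h a ha)
    convert! this using 1
    rw [dist_eq_norm, dist_eq_norm]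
    congr 1
    abel
  let g : (Fin n → ℝ) → ℝ := fun x => max 0 (1 - 2 / ε * d x)
  have hgL' : ∀ x y, g x - g y ≤ 2 / ε * ‖x - y‖ := by
    intro x y
    have h0 : 0 < 2 / ε := by positivity
    have := mul_le_mul_of_nonneg_left (hdL y x) h0.le
    rw [norm_sub_rev] at this
    have h3 := norm_nonneg (x - y)
    have h4 : 0 ≤ 2 / ε * ‖x - y‖ := by positivity
    have h1 : 0 ≤ g y := le_max_left _ _
    have h2 : 1 - 2 / ε * d y ≤ g y := le_max_right _ _
    rw [sub_le_iff_le_add]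
    refine max_le (by linarith) (by linarith)
  obtain ⟨F, F', M, hM, hF, hFg⟩ := exists_smoothIncreasing_of_lipschitz (I := I) (L := 2 / ε)
    (r := ε / 4) (g := g) (by positivity) (by positivity) (fun x => le_max_left _ _)
    (fun x => max_le zero_le_one (by
      have : 0 ≤ d x := Metric.infDist_nonneg
      have : 0 ≤ 2 / ε * d x := by positivity
      linarith))
    (fun x y => abs_sub_le_iff.2 ⟨hgL' x y, by rw [norm_sub_rev]; exact hgL' y x⟩)
    (fun x v hv => by
      refine max_le_max le_rfl ?_
      have := hd_le x (x + v) fun a ha => by rw [add_sub_cancel_left]; exact hA a ha v hv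
      gcongr)
    (fun x y hxy => by
      have h : ∀ x y : Fin n → ℝ, (∀ i ∈ I, x i = y i) → d y ≤ d x := fun x y hxy =>
        hd_le x y fun a ha => (hAI a _ fun i hi => by simp [hxy i hi]).1 ha
      have : d x = d y := le_antisymm (h y x fun i hi => (hxy i hi).symm) (h x y hxy)
      simp only [g, this])
  refine ⟨F, F', M, hM, hF, fun x hx => ?_, fun x hx => ?_⟩
  · have h1 : ∀ y ∈ Metric.ball x (ε / 4), g y = 1 := by
      intro y hy
      have hyA : y - s ∈ A := by
        refine key x _ _ hx fun i => ?_
        have := (norm_le_pi_norm (y - x) i).trans (mem_ball_iff_norm.1 hy).le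
        have := (abs_le.1 this).1
        simp only [Pi.sub_apply, s] at this ⊢
        linarith
      simp [g, d, Metric.infDist_zero_of_mem hyA]
    have h2 := h1 x (Metric.mem_ball_self (by positivity))
    rw [hFg x fun y hy => (h1 y hy).trans h2.symm, h2]
  · have h1 : ∀ y ∈ Metric.ball x (ε / 4), g y = 0 := by
      intro y hy
      refine max_eq_left ?_
      by_contra! hlt
      have hd : d y < ε / 2 := by
        have : 2 / ε * d y < 1 := by linarith
        rw [div_mul_eq_mul_div, div_lt_one hε] at this
        linarith
      obtain ⟨a, ha, hya⟩ := (Metric.infDist_lt_iff hne).1 hd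
      refine hx (key x _ a ha fun i => ?_)
      have e1 := (norm_le_pi_norm (y - x) i).trans (mem_ball_iff_norm.1 hy).le
      rw [dist_eq_norm] at hya
      have e2 := (norm_le_pi_norm (y - s - a) i).trans hya.le
      have e1 := (abs_le.1 e1).2
      have e2 := (abs_le.1 e2).1
      simp only [Pi.sub_apply, s] at e1 e2
      linarith
    have h2 := h1 x (Metric.mem_ball_self (by positivity))
    rw [hFg x fun y hy => (h1 y hy).trans h2.symm, h2]

namespace SmoothIncreasing

variable {n : ℕ} {I : Finset (Fin n)} {L M : ℝ} {F : (Fin n → ℝ) → ℝ}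
  {F' : (Fin n → ℝ) → Fin n → ℝ}

theorem abs_le_one (hF : SmoothIncreasing I L M F F') (x : Fin n → ℝ) : |F x| ≤ 1 := by
  rw [abs_of_nonneg (hF.nonneg x)]
  exact hF.le_one x

theorem grad_le (hF : SmoothIncreasing I L M F F') (x : Fin n → ℝ) (i : Fin n) : F' x i ≤ L :=
  (Finset.single_le_sum (fun j _ => hF.grad_nonneg x j) (Finset.mem_univ i)).trans
    (hF.sum_grad_le x)

theorem integrable_comp (hF : SmoothIncreasing I L M F F') {α : Type*} [MeasurableSpace α]
    {μ : Measure α} [IsFiniteMeasure μ] {φ : α → Fin n → ℝ} (hφ : AEMeasurable φ μ) :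
    Integrable (fun y => F (φ y)) μ :=
  .of_bound (hF.continuous.measurable.comp_aemeasurable hφ).aestronglyMeasurable 1
    (ae_of_all _ fun _ => hF.abs_le_one _)

theorem mono_remainder (hF : SmoothIncreasing I L M F F') {M' : ℝ} (h : M ≤ M') :
    SmoothIncreasing I L M' F F' :=
  { hF with taylor := fun x v => (hF.taylor x v).trans (by gcongr) }

theorem translate (hF : SmoothIncreasing I L M F F') (a : Fin n → ℝ) :
    SmoothIncreasing I L M (fun x => F (a + x)) (fun x => F' (a + x)) where
  continuous := by have := hF.continuous; fun_prop
  continuous_grad := by have := hF.continuous_grad; fun_prop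
  nonneg x := hF.nonneg _
  le_one x := hF.le_one _
  lipschitz x v := by rw [← add_assoc]; exact hF.lipschitz _ v
  grad_nonneg x := hF.grad_nonneg _
  sum_grad_le x := hF.sum_grad_le _
  grad_eq_zero x := hF.grad_eq_zero _
  taylor x v := by rw [← add_assoc]; exact hF.taylor _ v

/-- The class of smooth increasing functions is stable under averaging over translations. -/
theorem average (hF : SmoothIncreasing I L M F F') {α : Type*} [MeasurableSpace α]
    (μ : Measure α) [IsProbabilityMeasure μ] {φ : α → Fin n → ℝ} (hφ : Measurable φ) :
    SmoothIncreasing I L M (fun x => ∫ y, F (x + φ y) ∂μ)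
      (fun x i => ∫ y, F' (x + φ y) i ∂μ) := by
  have hFc := hF.continuous
  have hF'c := hF.continuous_grad
  have hint : ∀ x, Integrable (fun y => F (x + φ y)) μ := fun x =>
    hF.integrable_comp (by fun_prop)
  have hF'm : ∀ i, Measurable fun x => F' x i := fun i =>
    (Continuous.measurable (by fun_prop))
  have hbd : ∀ x i, ‖F' x i‖ ≤ L := fun x i => by
    rw [Real.norm_eq_abs, abs_of_nonneg (hF.grad_nonneg x i)]
    exact hF.grad_le x i
  have hint' : ∀ x i, Integrable (fun y => F' (x + φ y) i) μ := fun x i =>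
    .of_bound ((hF'm i).comp (by fun_prop)).aestronglyMeasurable L (ae_of_all _ fun y => hbd _ i)
  constructor
  · refine continuous_of_dominated (bound := fun _ => 1)
      (fun x => (hint x).aestronglyMeasurable) (fun x => ae_of_all _ fun y => ?_)
      (integrable_const _) (ae_of_all _ fun y => by fun_prop)
    exact hF.abs_le_one _
  · refine continuous_pi fun i => continuous_of_dominated (bound := fun _ => L)
      (fun x => (hint' x i).aestronglyMeasurable) (fun x => ae_of_all _ fun y => hbd _ i)
      (integrable_const _) (ae_of_all _ fun y => by fun_prop)
  · exact fun x => integral_nonneg fun y => hF.nonneg _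
  · intro x
    calc _ ≤ ∫ y, (1 : ℝ) ∂μ := integral_mono (hint x) (integrable_const _) fun y => hF.le_one _
      _ = 1 := by simp
  · intro x v
    rw [← integral_sub (hint _) (hint _), ← Real.norm_eq_abs]
    calc _ ≤ ∫ y, L * ‖v‖ ∂μ := by
          refine norm_integral_le_of_norm_le (integrable_const _) (ae_of_all _ fun y => ?_)
          rw [add_right_comm]
          exact hF.lipschitz _ v
      _ = _ := by simp
  · exact fun x i => integral_nonneg fun y => hF.grad_nonneg _ i
  · intro x
    rw [← integral_finsetSum _ fun i _ => hint' x i]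
    calc _ ≤ ∫ y, L ∂μ := integral_mono (integrable_finsetSum _ fun i _ => hint' x i)
          (integrable_const _) fun y => hF.sum_grad_le _
      _ = L := by simp
  · intro x i hi
    simp [hF.grad_eq_zero _ i hi]
  · intro x v
    have h1 : ∑ i, (∫ y, F' (x + φ y) i ∂μ) * v i = ∫ y, ∑ i, F' (x + φ y) i * v i ∂μ := by
      rw [integral_finsetSum _ fun i _ => (hint' x i).mul_const _]
      simp_rw [integral_mul_const]
    have h2 : Integrable (fun y => ∑ i, F' (x + φ y) i * v i) μ :=
      integrable_finsetSum _ fun i _ => (hint' x i).mul_const _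
    rw [h1, ← integral_sub (hint _) (hint _),
      ← integral_sub (f := fun y => F (x + v + φ y) - F (x + φ y)) ((hint _).sub (hint _)) h2,
      ← Real.norm_eq_abs]
    calc _ ≤ ∫ y, M * ‖v‖ ^ 2 ∂μ := by
          refine norm_integral_le_of_norm_le (integrable_const _) (ae_of_all _ fun y => ?_)
          rw [add_right_comm]
          exact hF.taylor _ v
      _ = _ := by simp

end SmoothIncreasing

/-- If `X` and `Y` are dominated by multiples of `f` and `g`, then so is their covariance by
the moments of `f` and `g`. -/
theorem abs_covariance_le_of_abs_le {Ω : Type*} [MeasurableSpace Ω] {μ : Measure Ω}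
    [IsProbabilityMeasure μ] {X Y f g : Ω → ℝ} {a b : ℝ} (hX : MemLp X 2 μ) (hY : MemLp Y 2 μ)
    (hf : Integrable f μ) (hg : Integrable g μ) (hfg : Integrable (fun ω => f ω * g ω) μ)
    (hXf : ∀ ω, |X ω| ≤ a * f ω) (hYg : ∀ ω, |Y ω| ≤ b * g ω) :
    |cov[X, Y; μ]| ≤ a * b * (∫ ω, f ω * g ω ∂μ + (∫ ω, f ω ∂μ) * ∫ ω, g ω ∂μ) := by
  have h1 : |∫ ω, X ω ∂μ| ≤ a * ∫ ω, f ω ∂μ := by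
    rw [← integral_const_mul]
    exact norm_integral_le_of_norm_le (hf.const_mul a) (ae_of_all _ fun ω => (Real.norm_eq_abs _).trans_le (hXf ω))
  have h2 : |∫ ω, Y ω ∂μ| ≤ b * ∫ ω, g ω ∂μ := by
    rw [← integral_const_mul]
    exact norm_integral_le_of_norm_le (hg.const_mul b) (ae_of_all _ fun ω => (Real.norm_eq_abs _).trans_le (hYg ω))
  have h3 : |∫ ω, (X * Y) ω ∂μ| ≤ a * b * ∫ ω, f ω * g ω ∂μ := by
    rw [← integral_const_mul, ← Real.norm_eq_abs]
    refine norm_integral_le_of_norm_le (hfg.const_mul _) (ae_of_all _ fun ω => ?_)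
    rw [Pi.mul_apply, norm_mul, Real.norm_eq_abs, Real.norm_eq_abs]
    calc _ ≤ (a * f ω) * (b * g ω) :=
          mul_le_mul (hXf ω) (hYg ω) (abs_nonneg _) ((abs_nonneg _).trans (hXf ω))
      _ = _ := by ring
  rw [covariance_eq_sub hX hY]
  calc _ ≤ |∫ ω, (X * Y) ω ∂μ| + |(∫ ω, X ω ∂μ) * ∫ ω, Y ω ∂μ| := abs_sub _ _
    _ ≤ a * b * ∫ ω, f ω * g ω ∂μ + (a * ∫ ω, f ω ∂μ) * (b * ∫ ω, g ω ∂μ) := by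
      rw [abs_mul]
      exact add_le_add h3 (mul_le_mul h1 h2 (abs_nonneg _) ((abs_nonneg _).trans h1))
    _ = _ := by ring

/-- For a small Gaussian perturbation, the covariance of two smooth increasing functions is
governed by their gradients. -/
theorem exists_forall_le_covariance_smul {n : ℕ} {I₁ I₂ : Finset (Fin n)} {κ L M : ℝ}
    (hκ : 0 ≤ κ) (hL : 0 ≤ L)
    (μ : Measure (Fin n → ℝ)) [IsGaussian μ]
    (hcov : ∀ i ∈ I₁, ∀ j ∈ I₂, -κ ≤ cov[fun x => x i, fun x => x j; μ]) :
    ∃ C, ∀ h : ℝ, 0 ≤ h → ∀ F F' G G', SmoothIncreasing I₁ L M F F' →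
      SmoothIncreasing I₂ L M G G' →
      -(κ * L ^ 2 * h ^ 2 + C * h ^ 3) ≤ cov[fun x => F (h • x), fun x => G (h • x); μ] := by
  have hmom : ∀ k : ℕ, Integrable (fun x : Fin n → ℝ => ‖x‖ ^ k) μ := fun k =>
    (IsGaussian.memLp_id μ k (by simp)).integrable_norm_pow'
  have hmem : ∀ (k : ℕ) (c : ℝ) (U : (Fin n → ℝ) → ℝ), Continuous U →
      (∀ x, |U x| ≤ c * ‖x‖ ^ k) → MemLp U 2 μ := by
    intro k c U hU hUc
    refine (memLp_two_iff_integrable_sq hU.aestronglyMeasurable).2 ?_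
    refine ((hmom (k * 2)).const_mul (c ^ 2)).mono' (by fun_prop) (ae_of_all _ fun x => ?_)
    rw [Real.norm_eq_abs, abs_pow, pow_mul, ← mul_pow]
    exact pow_le_pow_left₀ (abs_nonneg _) (hUc x) 2
  set m := ∫ x, ‖x‖ * ‖x‖ ^ 2 ∂μ + (∫ x, ‖x‖ ∂μ) * ∫ x, ‖x‖ ^ 2 ∂μ with hm
  have hi1 : Integrable (fun x : Fin n → ℝ => ‖x‖) μ := by simpa using hmom 1
  have hi3 : Integrable (fun x : Fin n → ℝ => ‖x‖ * ‖x‖ ^ 2) μ := by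
    simpa [← pow_succ'] using hmom 3
  refine ⟨2 * (L * M * m), fun h hh F F' G G' hF hG => ?_⟩
  have hFc := hF.continuous
  have hGc := hG.continuous
  let lin : (Fin n → ℝ) → (Fin n → ℝ) → ℝ := fun w x => ∑ i, w i * (h • x) i
  have hlin : ∀ w : Fin n → ℝ, (∀ i, 0 ≤ w i) → ∑ i, w i ≤ L → ∀ x, |lin w x| ≤ h * L * ‖x‖ := by
    intro w hw hwL x
    calc _ ≤ ∑ i, |w i * (h • x) i| := Finset.abs_sum_le_sum_abs _ _
      _ ≤ ∑ i, w i * (h * ‖x‖) := by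
        refine Finset.sum_le_sum fun i _ => ?_
        rw [abs_mul, abs_of_nonneg (hw i), Pi.smul_apply, smul_eq_mul, abs_mul, abs_of_nonneg hh]
        have := hw i
        gcongr
        exact norm_le_pi_norm x i
      _ ≤ L * (h * ‖x‖) := by rw [← Finset.sum_mul]; gcongr
      _ = _ := by ring
  have hlinc : ∀ w, Continuous (lin w) := fun w => by fun_prop
  have hnorm : ∀ x : Fin n → ℝ, ‖h • x‖ = h * ‖x‖ := fun x => by
    rw [norm_smul, Real.norm_eq_abs, abs_of_nonneg hh]
  set a := lin (F' 0) with ha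
  set b := lin (G' 0) with hb
  set r : (Fin n → ℝ) → ℝ := fun x => F (h • x) - F 0 - a x with hr
  set s : (Fin n → ℝ) → ℝ := fun x => G (h • x) - G 0 - b x with hs
  set u : (Fin n → ℝ) → ℝ := fun x => G (h • x) - G 0 with hu
  have hac : Continuous a := hlinc _
  have hbc : Continuous b := hlinc _
  have hale := hlin (F' 0) (hF.grad_nonneg 0) (hF.sum_grad_le 0)
  have hble := hlin (G' 0) (hG.grad_nonneg 0) (hG.sum_grad_le 0)
  have hrle : ∀ x, |r x| ≤ M * h ^ 2 * ‖x‖ ^ 2 := fun x => by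
    have := hF.taylor 0 (h • x)
    rwa [zero_add, hnorm, mul_pow, ← mul_assoc] at this
  have hsle : ∀ x, |s x| ≤ M * h ^ 2 * ‖x‖ ^ 2 := fun x => by
    have := hG.taylor 0 (h • x)
    rwa [zero_add, hnorm, mul_pow, ← mul_assoc] at this
  have hule : ∀ x, |u x| ≤ h * L * ‖x‖ := fun x => by
    have := hG.lipschitz 0 (h • x)
    rw [zero_add, hnorm] at this
    linarith
  have haL : MemLp a 2 μ := hmem 1 _ a hac (by simpa using hale)
  have hbL : MemLp b 2 μ := hmem 1 _ b hbc (by simpa using hble)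
  have huL : MemLp u 2 μ := hmem 1 _ u (by fun_prop) (by simpa using hule)
  have hrL : MemLp r 2 μ := hmem 2 _ r (by fun_prop) hrle
  have hsL : MemLp s 2 μ := hmem 2 _ s (by fun_prop) hsle
  have hsplit : cov[fun x => F (h • x), fun x => G (h • x); μ]
      = cov[a, b; μ] + cov[a, s; μ] + cov[u, r; μ] := by
    have h1 : (fun x => F (h • x)) = fun x => (a + r) x + F 0 := by
      funext x; simp [hr]
    have h2 : (fun x => G (h • x)) = fun x => u x + G 0 := by
      funext x; simp [hu]
    have h3 : u = b + s := by
      funext x; simp [hu, hs]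
    rw [h1, h2, covariance_add_const_left ((haL.add hrL).integrable (by norm_num)),
      covariance_add_const_right (huL.integrable (by norm_num)),
      covariance_add_left haL hrL huL, covariance_comm r u]
    conv_lhs => enter [1, 2]; rw [h3]
    rw [covariance_add_right haL hbL hsL]
  have has := abs_covariance_le_of_abs_le haL hsL hi1 (hmom 2) hi3 hale hsle
  have hur := abs_covariance_le_of_abs_le huL hrL hi1 (hmom 2) hi3 hule hrle
  have hab : -(κ * L ^ 2 * h ^ 2) ≤ cov[a, b; μ] := by
    have hcoord : ∀ (w : Fin n → ℝ) i, MemLp (fun x : Fin n → ℝ => w i * (h • x) i) 2 μ := by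
      intro w i
      refine hmem 1 (|w i| * h) _ (by fun_prop) fun x => ?_
      rw [abs_mul, Pi.smul_apply, smul_eq_mul, abs_mul, abs_of_nonneg hh, mul_assoc, pow_one]
      gcongr
      exact norm_le_pi_norm x i
    have h1 : cov[a, b; μ] = ∑ i, ∑ j, F' 0 i * G' 0 j * h ^ 2 *
        cov[fun x => x i, fun x => x j; μ] := by
      rw [ha, hb, covariance_fun_sum_fun_sum (fun i => hcoord _ i) (fun i => hcoord _ i)]
      refine Finset.sum_congr rfl fun i _ => Finset.sum_congr rfl fun j _ => ?_
      simp only [Pi.smul_apply, smul_eq_mul]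
      rw [covariance_const_mul_left, covariance_const_mul_left, covariance_const_mul_right,
        covariance_const_mul_right]
      ring
    have h2 : ∑ i, ∑ j, F' 0 i * G' 0 j * h ^ 2 * (-κ) ≤ cov[a, b; μ] := by
      rw [h1]
      refine Finset.sum_le_sum fun i _ => Finset.sum_le_sum fun j _ => ?_
      by_cases hi : i ∈ I₁
      · by_cases hj : j ∈ I₂
        · have := hF.grad_nonneg 0 i
          have := hG.grad_nonneg 0 j
          exact mul_le_mul_of_nonneg_left (hcov i hi j hj) (by positivity)
        · simp [hG.grad_eq_zero 0 j hj]
      · simp [hF.grad_eq_zero 0 i hi]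
    have h3 : ∑ i, ∑ j, F' 0 i * G' 0 j * h ^ 2 * (-κ)
        = -(κ * h ^ 2 * ((∑ i, F' 0 i) * ∑ j, G' 0 j)) := by
      rw [Finset.sum_mul_sum, Finset.mul_sum, ← Finset.sum_neg_distrib]
      refine Finset.sum_congr rfl fun i _ => ?_
      rw [Finset.mul_sum, ← Finset.sum_neg_distrib]
      exact Finset.sum_congr rfl fun j _ => by ring
    have h4 : (∑ i, F' 0 i) * ∑ j, G' 0 j ≤ L * L :=
      mul_le_mul (hF.sum_grad_le 0) (hG.sum_grad_le 0)
        (Finset.sum_nonneg fun j _ => hG.grad_nonneg 0 j) hL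
    have h5 := mul_le_mul_of_nonneg_left h4 (show 0 ≤ κ * h ^ 2 by positivity)
    linarith
  rw [hsplit]
  have e1 := (abs_le.1 has).1
  have e2 := (abs_le.1 hur).1
  rw [← hm] at e1 e2
  have e3 : h * L * (M * h ^ 2) * m = L * M * m * h ^ 3 := by ring
  rw [e3] at e1 e2
  linarith

namespace SmoothIncreasing

variable {n : ℕ} {I : Finset (Fin n)} {L M : ℝ} {F : (Fin n → ℝ) → ℝ}
  {F' : (Fin n → ℝ) → Fin n → ℝ}

theorem memLp_comp (hF : SmoothIncreasing I L M F F') {α : Type*} [MeasurableSpace α]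
    {μ : Measure α} [IsFiniteMeasure μ] {φ : α → Fin n → ℝ} (hφ : AEMeasurable φ μ)
    (p : ENNReal) : MemLp (fun y => F (φ y)) p μ :=
  .of_bound (hF.integrable_comp hφ).aestronglyMeasurable 1 (ae_of_all _ fun _ => hF.abs_le_one _)

end SmoothIncreasing

/-- A centered Gaussian measure dilated by `√2` is the convolution of the measure with itself. -/
theorem integral_comp_sqrt_two_mul_smul {E : Type*} [NormedAddCommGroup E] [NormedSpace ℝ E]
    [CompleteSpace E] [SecondCountableTopology E] [MeasurableSpace E] [BorelSpace E]
    {μ : Measure E} [IsGaussian μ] (hμ : ∫ x, x ∂μ = 0) {f : E → ℝ} (hf : Measurable f)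
    {C : ℝ} (hfC : ∀ x, ‖f x‖ ≤ C) (h : ℝ) :
    ∫ x, f ((√2 * h) • x) ∂μ = ∫ x, ∫ y, f (h • x + h • y) ∂μ ∂μ := by
  have hm : Measurable fun z : E × E => f (h • z.1 + h • z.2) := by fun_prop
  rw [integral_integral (f := fun x y => f (h • x + h • y))
    (.of_bound hm.aestronglyMeasurable C (ae_of_all _ fun z => hfC _))]
  have hrot := IsGaussian.map_rotation_eq_self (μ := μ) (by simpa using hμ) (Real.pi / 4)
  calc _ = ∫ z : E × E, f ((√2 * h) • z.1) ∂(μ.prod μ) := by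
        rw [integral_fun_fst (fun x => f ((√2 * h) • x))]; simp
    _ = ∫ z : E × E, f ((√2 * h) • z.1)
          ∂((μ.prod μ).map (ContinuousLinearMap.rotation (Real.pi / 4))) := by rw [hrot]
    _ = _ := by
      rw [integral_map (by fun_prop) (Measurable.aestronglyMeasurable (by fun_prop))]
      refine integral_congr_ae (ae_of_all _ fun z => ?_)
      simp only [ContinuousLinearMap.rotation_apply, Real.cos_pi_div_four, Real.sin_pi_div_four,
        smul_add, smul_smul]
      have : √2 * h * (√2 / 2) = h := by
        have := Real.mul_self_sqrt (show (0 : ℝ) ≤ 2 by norm_num)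
        linear_combination (h / 2) * this
      rw [this]

section Interpolation

variable {n : ℕ} {I₁ I₂ : Finset (Fin n)} {κ L M : ℝ} {μ : Measure (Fin n → ℝ)} [IsGaussian μ]

/-- Passing from the scale `h` to the scale `√2 * h` at most doubles the covariance defect of
smooth increasing functions of a centered Gaussian vector. -/
theorem le_covariance_sqrt_two_mul_smul (hμ : ∫ x, x ∂μ = 0) {h b : ℝ}
    (hb : ∀ F F' G G', SmoothIncreasing I₁ L M F F' → SmoothIncreasing I₂ L M G G' →
      -b ≤ cov[fun x => F (h • x), fun x => G (h • x); μ])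
    {F F' G G'} (hF : SmoothIncreasing I₁ L M F F') (hG : SmoothIncreasing I₂ L M G G') :
    -(2 * b) ≤ cov[fun x => F ((√2 * h) • x), fun x => G ((√2 * h) • x); μ] := by
  have hφ : ∀ c : ℝ, AEMeasurable (fun x : Fin n → ℝ => c • x) μ := fun c => by fun_prop
  have hFc := hF.continuous
  have hGc := hG.continuous
  have hFa := hF.average μ (φ := fun y => h • y) (by fun_prop)
  have hGa := hG.average μ (φ := fun y => h • y) (by fun_prop)
  have e1 := hb _ _ _ _ hFa hGa
  have e2 : ∀ x, (∫ y, F (h • x + h • y) ∂μ) * (∫ y, G (h • x + h • y) ∂μ) - b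
      ≤ ∫ y, F (h • x + h • y) * G (h • x + h • y) ∂μ := fun x => by
    have hFt := hF.translate (h • x)
    have hGt := hG.translate (h • x)
    have := hb _ _ _ _ hFt hGt
    rw [covariance_eq_sub (hFt.memLp_comp (hφ h) 2) (hGt.memLp_comp (hφ h) 2)] at this
    simp only [Pi.mul_apply] at this
    linarith
  have hbd : ∀ x, ‖F x * G x‖ ≤ 1 := fun x => by
    rw [norm_mul]
    exact mul_le_one₀ (hF.abs_le_one x) (norm_nonneg _) (hG.abs_le_one x)
  rw [covariance_eq_sub (hFa.memLp_comp (hφ h) 2) (hGa.memLp_comp (hφ h) 2)] at e1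
  rw [covariance_eq_sub (hF.memLp_comp (hφ _) 2) (hG.memLp_comp (hφ _) 2)]
  simp only [Pi.mul_apply] at e1 ⊢
  rw [integral_comp_sqrt_two_mul_smul hμ hFc.measurable hF.abs_le_one,
    integral_comp_sqrt_two_mul_smul hμ hGc.measurable hG.abs_le_one,
    integral_comp_sqrt_two_mul_smul (f := fun x => F x * G x) hμ (by fun_prop) hbd]
  have i1 : Integrable (fun x => (∫ y, F (h • x + h • y) ∂μ) * ∫ y, G (h • x + h • y) ∂μ) μ :=
    (hFa.memLp_comp (hφ h) 2).integrable_mul (hGa.memLp_comp (hφ h) 2)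
  have i2 : Integrable (fun x => ∫ y, F (h • x + h • y) * G (h • x + h • y) ∂μ) μ := by
    refine Integrable.integral_prod_left (f := fun z : (Fin n → ℝ) × (Fin n → ℝ) =>
      F (h • z.1 + h • z.2) * G (h • z.1 + h • z.2)) (μ := μ) (ν := μ) ?_
    exact .of_bound (Measurable.aestronglyMeasurable (by fun_prop)) 1
      (ae_of_all _ fun z => hbd _)
  have e3 := integral_mono (i1.sub (integrable_const b)) i2 e2
  simp only [Pi.sub_apply] at e3
  rw [integral_sub i1 (integrable_const b)] at e3
  simp only [integral_const, probReal_univ, one_smul] at e3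
  linarith

/-- Covariance lower bound for smooth increasing functions of a centered Gaussian vector. -/
theorem le_covariance_of_integral_eq_zero (hL : 0 ≤ L) (hκ : 0 ≤ κ)
    (hμ : ∫ x, x ∂μ = 0)
    (hcov : ∀ i ∈ I₁, ∀ j ∈ I₂, -κ ≤ cov[fun x => x i, fun x => x j; μ])
    {F F' G G'} (hF : SmoothIncreasing I₁ L M F F') (hG : SmoothIncreasing I₂ L M G G') :
    -(κ * L ^ 2) ≤ cov[F, G; μ] := by
  obtain ⟨C, hC⟩ := exists_forall_le_covariance_smul (M := M) hκ hL μ hcov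
  have hiter : ∀ (k : ℕ) (h b : ℝ),
      (∀ F F' G G', SmoothIncreasing I₁ L M F F' → SmoothIncreasing I₂ L M G G' →
        -b ≤ cov[fun x => F (h • x), fun x => G (h • x); μ]) →
      ∀ F F' G G', SmoothIncreasing I₁ L M F F' → SmoothIncreasing I₂ L M G G' →
        -(2 ^ k * b) ≤ cov[fun x => F ((√2 ^ k * h) • x), fun x => G ((√2 ^ k * h) • x); μ] := by
    intro k h b hb
    induction k with
    | zero => simpa using hb
    | succ k ih =>
      intro F F' G G' hF hG
      have := le_covariance_sqrt_two_mul_smul hμ ih hF hG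
      rwa [← mul_assoc, ← mul_assoc, ← pow_succ', ← pow_succ'] at this
  have hk : ∀ k : ℕ, -(κ * L ^ 2 + C * (√2)⁻¹ ^ k) ≤ cov[F, G; μ] := by
    intro k
    have h0 : √2 ^ k ≠ 0 := by positivity
    have h1 : (2 : ℝ) ^ k = (√2 ^ k) ^ 2 := by
      rw [← pow_mul, mul_comm, pow_mul, Real.sq_sqrt (by norm_num)]
    have := hiter k ((√2 ^ k)⁻¹) _ (hC _ (by positivity)) F F' G G' hF hG
    rw [mul_inv_cancel₀ h0, h1] at this
    simp only [one_smul] at this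
    refine le_trans (le_of_eq ?_) this
    rw [inv_pow]
    field_simp
  have hlim : Filter.Tendsto (fun k : ℕ => -(κ * L ^ 2 + C * (√2)⁻¹ ^ k)) Filter.atTop
      (nhds (-(κ * L ^ 2 + C * 0))) := by
    refine ((tendsto_pow_atTop_nhds_zero_of_lt_one (by positivity) ?_).const_mul C).const_add _
      |>.neg
    exact inv_lt_one_of_one_lt₀ (Real.lt_sqrt_of_sq_lt (by norm_num))
  simpa using le_of_tendsto' hlim hk

/-- Covariance lower bound for smooth increasing functions of a Gaussian vector whose relevant
cross-covariances are bounded below. -/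
theorem le_covariance_of_smoothIncreasing (hL : 0 ≤ L) (hκ : 0 ≤ κ)
    (hcov : ∀ i ∈ I₁, ∀ j ∈ I₂, -κ ≤ cov[fun x => x i, fun x => x j; μ])
    {F F' G G'} (hF : SmoothIncreasing I₁ L M F F') (hG : SmoothIncreasing I₂ L M G G') :
    -(κ * L ^ 2) ≤ cov[F, G; μ] := by
  set m := ∫ x, x ∂μ with hm
  have hid : Integrable (fun x : Fin n → ℝ => x) μ := IsGaussian.integrable_id
  have hcoord : ∀ i, Integrable (fun x : Fin n → ℝ => x i) μ := fun i => hid.eval i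
  have hF' := hF.translate m
  have hG' := hG.translate m
  have hFc := hF.continuous
  have hGc := hG.continuous
  have := le_covariance_of_integral_eq_zero (μ := μ.map fun x => x - m) hL hκ
    (by
      rw [integral_map (by fun_prop) (by fun_prop), integral_sub hid (integrable_const _)]
      simp [hm])
    (fun i hi j hj => by
      rw [covariance_map_fun (Measurable.aestronglyMeasurable (by fun_prop))
        (Measurable.aestronglyMeasurable (by fun_prop)) (by fun_prop)]
      simp only [Pi.sub_apply]
      rw [covariance_sub_const_left (hcoord i), covariance_sub_const_right (hcoord j)]
      exact hcov i hi j hj) hF' hG'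
  rw [covariance_map_fun (Continuous.aestronglyMeasurable (by fun_prop))
    (Continuous.aestronglyMeasurable (by fun_prop)) (by fun_prop)] at this
  simpa using this

end Interpolation

theorem IsGaussianVector.hasGaussianLaw {Ω : Type*} [MeasureSpace Ω] {n : ℕ}
    {X : Ω → Fin n → ℝ} (hX : IsGaussianVector X) : HasGaussianLaw X (ℙ : Measure Ω) := by
  have hm : AEMeasurable X ℙ := by
    refine aemeasurable_pi_iff.2 fun i => ?_
    obtain ⟨m, v, h⟩ := hX (Pi.single i 1)
    refine AEMeasurable.of_map_ne_zero ?_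
    simp only [Pi.single_apply, ite_mul, one_mul, zero_mul, Finset.sum_ite_eq',
      Finset.mem_univ, if_true] at h
    rw [h]
    exact IsProbabilityMeasure.ne_zero _
  refine ⟨isGaussian_of_map_eq_gaussianReal fun T => ?_⟩
  obtain ⟨m, v, h⟩ := hX fun i => T (Pi.single i 1)
  refine ⟨m, v, ?_⟩
  rw [← h, AEMeasurable.map_map_of_aemeasurable (by fun_prop) hm]
  congr 1
  funext ω
  rw [Function.comp_apply]
  conv_lhs => rw [← Finset.univ_sum_single (X ω), map_sum]
  refine Finset.sum_congr rfl fun i _ => ?_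
  rw [mul_comm, ← smul_eq_mul, ← map_smul, ← Pi.single_smul, smul_eq_mul, mul_one]

/-- Sprinkled association: the failure of positive association of increasing events is controlled
by the most negative cross-covariance. -/
theorem IsGaussianVector.sprinkled_association {Ω : Type*} [MeasureSpace Ω]
    [IsProbabilityMeasure (ℙ : Measure Ω)] {n : ℕ} {X : Ω → Fin n → ℝ} (hX : IsGaussianVector X)
    {I₁ I₂ : Finset (Fin n)} {A₁ A₂ : Set (Fin n → ℝ)} (hA₁ : IncreasingEvent A₁)
    (hA₂ : IncreasingEvent A₂) (hI₁ : SupportedOn A₁ ↑I₁) (hI₂ : SupportedOn A₂ ↑I₂)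
    {ε κ : ℝ} (hε : 0 < ε) (hκ : 0 ≤ κ)
    (hcov : ∀ i ∈ I₁, ∀ j ∈ I₂, -κ ≤ cov[fun ω => X ω i, fun ω => X ω j; ℙ]) :
    (ℙ {ω | (fun i => X ω i - ε) ∈ A₁}).toReal * (ℙ {ω | (fun i => X ω i - ε) ∈ A₂}).toReal
      - (ℙ {ω | X ω ∈ A₁ ∩ A₂}).toReal ≤ 4 * κ / ε ^ 2 := by
  have hlaw := hX.hasGaussianLaw
  have hXm := hlaw.aemeasurable
  have : IsGaussian ((ℙ : Measure Ω).map X) := hlaw.isGaussian_map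
  obtain ⟨F, F', M₁, -, hF, hF1, hF0⟩ := exists_smoothIncreasing_of_increasingEvent hA₁ hI₁ hε
  obtain ⟨G, G', M₂, -, hG, hG1, hG0⟩ := exists_smoothIncreasing_of_increasingEvent hA₂ hI₂ hε
  have hmain := le_covariance_of_smoothIncreasing (μ := (ℙ : Measure Ω).map X) (L := 2 / ε)
    (by positivity) hκ
    (fun i hi j hj => by
      rw [covariance_map_fun (Measurable.aestronglyMeasurable (by fun_prop))
        (Measurable.aestronglyMeasurable (by fun_prop)) hXm]
      exact hcov i hi j hj)
    (hF.mono_remainder (le_max_left M₁ M₂)) (hG.mono_remainder (le_max_right M₁ M₂))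
  rw [covariance_map_fun hF.continuous.aestronglyMeasurable hG.continuous.aestronglyMeasurable hXm,
    covariance_eq_sub (hF.memLp_comp hXm 2) (hG.memLp_comp hXm 2)] at hmain
  simp only [Pi.mul_apply] at hmain
  have hle : ∀ {A : Set (Fin n → ℝ)} {I M H H'}, SmoothIncreasing I (2 / ε) M H H' →
      (∀ x : Fin n → ℝ, (fun i => x i - ε) ∈ A → H x = 1) →
      (ℙ {ω | (fun i => X ω i - ε) ∈ A}).toReal ≤ ∫ ω, H (X ω) := by
    intro A I M H H' hH hH1
    calc _ ≤ (ℙ : Measure Ω).real {ω | 1 ≤ H (X ω)} :=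
          measureReal_mono fun ω hω => (hH1 _ hω).ge
      _ ≤ _ := by
        simpa using mul_meas_ge_le_integral_of_nonneg (ae_of_all ℙ fun ω => hH.nonneg (X ω))
          (hH.integrable_comp hXm) 1
  have hge : ∫ ω, F (X ω) * G (X ω) ≤ (ℙ {ω | X ω ∈ A₁ ∩ A₂}).toReal := by
    set S := {ω | X ω ∈ A₁ ∩ A₂} with hS
    set T := toMeasurable ℙ S with hT
    have hTm : MeasurableSet T := measurableSet_toMeasurable _ _
    calc _ ≤ ∫ ω, T.indicator (fun _ => (1 : ℝ)) ω := by
          refine integral_mono ((hF.memLp_comp hXm 2).integrable_mul (hG.memLp_comp hXm 2))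
            ((integrable_const _).indicator hTm) fun ω => ?_
          by_cases hω : ω ∈ T
          · rw [Set.indicator_of_mem hω]
            exact mul_le_one₀ (hF.le_one _) (hG.nonneg _) (hG.le_one _)
          · rw [Set.indicator_of_notMem hω]
            have hω' : ¬(X ω ∈ A₁ ∧ X ω ∈ A₂) := fun h => hω (subset_toMeasurable ℙ S h)
            rcases not_and_or.1 hω' with h | h
            · simp [hF0 _ h]
            · simp [hG0 _ h]
      _ = (ℙ T).toReal := by rw [integral_indicator_const _ hTm]; simp [Measure.real]
      _ = _ := by rw [hT, measure_toMeasurable]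
  have hprod := mul_le_mul (hle hF hF1) (hle hG hG1) ENNReal.toReal_nonneg
    (integral_nonneg fun ω => hF.nonneg _)
  have : κ * (2 / ε) ^ 2 = 4 * κ / ε ^ 2 := by ring
  linarith

theorem abs_le_kNorm {n : ℕ} (K : Fin n → Fin n → ℝ) {I₁ I₂ : Finset (Fin n)} {i j : Fin n}
    (hi : i ∈ I₁) (hj : j ∈ I₂) : |K i j| ≤ kNorm K I₁ I₂ := by
  refine le_csSup (Set.Finite.bddAbove ?_) ⟨i, hi, j, hj, rfl⟩
  refine (Set.finite_range fun p : Fin n × Fin n => |K p.1 p.2|).subset ?_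
  rintro r ⟨i, -, j, -, rfl⟩
  exact ⟨(i, j), rfl⟩

theorem kNorm_nonneg {n : ℕ} (K : Fin n → Fin n → ℝ) (I₁ I₂ : Finset (Fin n)) :
    0 ≤ kNorm K I₁ I₂ := by
  refine Real.sSup_nonneg ?_
  rintro r ⟨i, -, j, -, rfl⟩
  exact abs_nonneg _

theorem stmt6 :
    ∃ c : ℝ, 0 < c ∧
      ∀ (n : ℕ) (Ω : Type) (_ : MeasureSpace Ω)
        (_ : IsProbabilityMeasure (ℙ : Measure Ω))
        (X : Ω → Fin n → ℝ), IsGaussianVector X →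
        ∀ (K : Fin n → Fin n → ℝ),
          (∀ i j, K i j = ∫ ω, X ω i * X ω j ∂ℙ -
            (∫ ω, X ω i ∂ℙ) * (∫ ω, X ω j ∂ℙ)) →
        ∀ (I1 I2 : Finset (Fin n)) (A1 A2 : Set (Fin n → ℝ)),
          IncreasingEvent A1 → IncreasingEvent A2 →
          SupportedOn A1 ↑I1 → SupportedOn A2 ↑I2 →
          ∀ ε : ℝ, 0 < ε →
            ((ℙ {ω | (fun i => X ω i - ε) ∈ A1}).toReal *
                  (ℙ {ω | (fun i => X ω i - ε) ∈ A2}).toReal -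
                (ℙ {ω | X ω ∈ A1 ∩ A2}).toReal ≤
              c * kNorm K I1 I2 / ε ^ 2) ∧
            ((∀ i ∈ I1, ∀ j ∈ I2, 0 ≤ K i j) →
              (ℙ {ω | (fun i => X ω i - ε) ∈ A1}).toReal *
                  (ℙ {ω | (fun i => X ω i - ε) ∈ A2}).toReal -
                (ℙ {ω | X ω ∈ A1 ∩ A2}).toReal ≤ 0) := by
  refine ⟨4, by norm_num, ?_⟩
  intro n Ω _ _ X hX K hK I1 I2 A1 A2 hA1 hA2 hI1 hI2 ε hε
  have hcov : ∀ i j, K i j = cov[fun ω => X ω i, fun ω => X ω j; ℙ] := fun i j => by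
    rw [hK, covariance_eq_sub (hX.hasGaussianLaw.eval i).memLp_two
      (hX.hasGaussianLaw.eval j).memLp_two]
    rfl
  refine ⟨?_, fun hpos => ?_⟩
  · refine hX.sprinkled_association hA1 hA2 hI1 hI2 hε (kNorm_nonneg K I1 I2) fun i hi j hj => ?_
    rw [← hcov]
    exact (abs_le.1 (abs_le_kNorm K hi hj)).1
  · have := hX.sprinkled_association hA1 hA2 hI1 hI2 hε le_rfl fun i hi j hj => by
      rw [← hcov, neg_zero]
      exact hpos i hi j hj
    simpa using this
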